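/- arXiv:1710.04634 — 7 statements merged into one kernel-verified Lean document; each statement's English description precedes it below -/
import Mathlib

section
/- Let S be a transformation semigroupoid on a nonempty set X and let f, g, h ∈ S. If f∘(g∘h) is defined, then (f∘g)∘h is defined. -/
/-- Composite of partial functions on `X`: `(f ∘ g)(x) = f (g x)`. -/
def pcomp {X : Type*} (f g : X →. X) : X →. X := fun x => (g x).bind f

/-- `f ∘ g` is defined iff `Dom(f) ⊇ im(g)`. -/
def PComposable {X : Type*} (f g : X →. X) : Prop := g.ran ⊆ f.Dom

/-- A transformation on `X`: a partial function together with a codomain containing its image. -/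
structure Tf (X : Type*) where
  toFun : X →. X
  cod : Set X
  ran_subset : toFun.ran ⊆ cod

/-- `f ∘ g` is defined iff `Dom(f) ⊇ im(g)`. -/
def TfComposable {X : Type*} (f g : Tf X) : Prop := g.toFun.ran ⊆ f.toFun.Dom

/-- Composite of transformations: `Dom(f∘g) = Dom(g)` (when defined), `cod(f∘g) = cod(f)`,
`(f∘g)(x) = f(g(x))`. -/
def Tf.comp {X : Type*} (f g : Tf X) : Tf X where
  toFun := pcomp f.toFun g.toFun
  cod := f.cod
  ran_subset := by
    rintro y ⟨x, hx⟩
    simp only [pcomp] at hx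
    rcases Part.mem_bind_iff.mp hx with ⟨z, hz, hfz⟩
    exact f.ran_subset ⟨z, hfz⟩

/-- The identity transformation on `S ⊆ X`. -/
def IdTf {X : Type*} (S : Set X) : Tf X where
  toFun := fun x => ⟨x ∈ S, fun _ => x⟩
  cod := S
  ran_subset := by
    rintro y ⟨x, h, rfl⟩
    exact h

/-- A transformation magma on `X`: a set of transformations with nonempty domains,
closed under composition. -/
def IsTfMagma {X : Type*} (S : Set (Tf X)) : Prop :=
  (∀ f ∈ S, f.toFun.Dom.Nonempty) ∧
  ∀ f ∈ S, ∀ g ∈ S, TfComposable f g → Tf.comp f g ∈ S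

/-- A transformation semigroupoid: a transformation magma in which
`Dom(f) ⊇ im(g)` implies `Dom(f) = cod(g)`. -/
def IsTfSemigroupoid {X : Type*} (S : Set (Tf X)) : Prop :=
  IsTfMagma S ∧ ∀ f ∈ S, ∀ g ∈ S, g.toFun.ran ⊆ f.toFun.Dom → f.toFun.Dom = g.cod

/-- A transformation poloid: a transformation semigroupoid containing the identity
transformations on the domain and codomain of each of its members. -/
def IsTfPoloid {X : Type*} (S : Set (Tf X)) : Prop :=
  IsTfSemigroupoid S ∧ ∀ f ∈ S, IdTf f.toFun.Dom ∈ S ∧ IdTf f.cod ∈ S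

/-- `e` is a unit of the transformation magma `S`. -/
def IsTfUnit {X : Type*} (S : Set (Tf X)) (e : Tf X) : Prop :=
  (∀ g ∈ S, TfComposable e g → Tf.comp e g = g) ∧
  (∀ g ∈ S, TfComposable g e → Tf.comp g e = g)

/-- In a transformation semigroupoid, if `f∘(g∘h)` is defined then `(f∘g)∘h` is defined. -/
theorem stmt4 {X : Type*} [Nonempty X] (S : Set (Tf X)) (hS : IsTfSemigroupoid S)
    (f g h : Tf X) (hf : f ∈ S) (hg : g ∈ S) (hh : h ∈ S)
    (h1 : TfComposable g h) (h2 : TfComposable f (Tf.comp g h)) :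
    TfComposable f g ∧ TfComposable (Tf.comp f g) h := by
  have hfg : TfComposable f g := by
    have hdom : f.toFun.Dom = g.cod := hS.2 f hf (Tf.comp g h) (hS.1.2 g hg h hh h1) h2
    exact g.ran_subset.trans hdom.ge
  refine ⟨hfg, fun y hy => ?_⟩
  obtain ⟨z, hz⟩ := (PFun.mem_dom _ _).1 (h1 hy)
  obtain ⟨w, hw⟩ := (PFun.mem_dom _ _).1 (hfg ⟨y, hz⟩)
  exact (PFun.mem_dom _ _).2 ⟨w, Part.mem_bind hz hw⟩
end

section
/- Let P be a poloid and x, y ∈ P. Then xy is defined if and only if ε_x = ϵ_y, where ε_x is the (unique) effective right unit of x and ϵ_y is the (unique) effective left unit of y. -/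
/-- `e` is a unit of the partial magma `op`: `ex = x` whenever `ex` is defined and
`xe = x` whenever `xe` is defined. -/
def OIsUnit {M : Type*} (op : M → M → Option M) (e : M) : Prop :=
  (∀ x y, op e x = some y → y = x) ∧ (∀ x y, op x e = some y → y = x)

/-- A semigroupoid: whenever `xy` and `yz` are both defined, or `(xy)z` is defined,
or `x(yz)` is defined, both `(xy)z` and `x(yz)` are defined and equal. -/
def IsSemigroupoid {M : Type*} (op : M → M → Option M) : Prop :=
  ∀ x y z : M,
    ((op x y).isSome ∧ (op y z).isSome) ∨
      ((op x y).bind (fun w => op w z)).isSome ∨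
      ((op y z).bind (fun w => op x w)).isSome →
    ((op x y).bind (fun w => op w z)).isSome ∧
      (op x y).bind (fun w => op w z) = (op y z).bind (fun w => op x w)

/-- A poloid: a semigroupoid in which every element has an effective left unit and an
effective right unit. -/
def IsPoloid {M : Type*} (op : M → M → Option M) : Prop :=
  IsSemigroupoid op ∧
    ∀ x : M, ∃ el er : M, OIsUnit op el ∧ OIsUnit op er ∧ (op el x).isSome ∧ (op x er).isSome

/-- In a poloid, `xy` is defined iff the effective right unit of `x` equals the effective
left unit of `y`. -/
theorem stmt11 {M : Type*} (op : M → M → Option M) (hP : IsPoloid op)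
    (x y εx ϵy : M)
    (hεx : OIsUnit op εx) (hεxd : (op x εx).isSome)
    (hϵy : OIsUnit op ϵy) (hϵyd : (op ϵy y).isSome) :
    (op x y).isSome ↔ εx = ϵy := by
  obtain ⟨hS, -⟩ := hP
  obtain ⟨u, hu⟩ := Option.isSome_iff_exists.mp hεxd
  obtain rfl := hεx.2 _ _ hu
  obtain ⟨v, hv⟩ := Option.isSome_iff_exists.mp hϵyd
  obtain rfl := hϵy.1 _ _ hv
  constructor
  · intro hxy
    obtain ⟨h, h_eq⟩ := hS u εx v (.inr (.inl (by simpa [hu] using hxy)))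
    rw [h_eq] at h
    have hεy : (op εx v).isSome := by
      cases hop : op εx v <;> simp_all
    obtain ⟨h', -⟩ := hS εx ϵy v (.inr (.inr (by simpa [hv] using hεy)))
    cases hop : op εx ϵy with
    | none => simp [hop] at h'
    | some w => exact (hϵy.2 _ _ hop).symm.trans (hεx.1 _ _ hop)
  · rintro rfl
    simpa [hu] using (hS u εx v (.inl ⟨hεxd, hϵyd⟩)).1
end

section
/- A poloid with exactly one unit is a monoid: if P is a poloid with a unique unit e, then xy is defined for all x, y ∈ P, the operation is associative ((xy)z = x(yz) for all x, y, z ∈ P), and ex = x = xe for all x ∈ P. -/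
/-- A poloid with exactly one unit is a monoid: the operation is total, associative, and the
unique unit is a two-sided identity. -/
theorem stmt13 {M : Type*} (op : M → M → Option M) (hP : IsPoloid op)
    (e : M) (he : OIsUnit op e) (huniq : ∀ e', OIsUnit op e' → e' = e) :
    (∀ x y : M, (op x y).isSome) ∧
    (∀ x y z : M, (op x y).bind (fun w => op w z) = (op y z).bind (fun w => op x w)) ∧
    (∀ x : M, op e x = some x ∧ op x e = some x) := by
  obtain ⟨hS, hU⟩ := hP
  have hid : ∀ x : M, op e x = some x ∧ op x e = some x := by
    intro x
    obtain ⟨el, er, hl, hr, hlx, hxr⟩ := hU x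
    rw [huniq el hl] at hlx
    rw [huniq er hr] at hxr
    obtain ⟨y, hy⟩ := Option.isSome_iff_exists.mp hlx
    obtain ⟨z, hz⟩ := Option.isSome_iff_exists.mp hxr
    exact ⟨he.1 x y hy ▸ hy, he.2 x z hz ▸ hz⟩
  have htotal : ∀ x y : M, (op x y).isSome := by
    intro x y
    have h := (hS x e y (Or.inl ⟨by simp [(hid x).2], by simp [(hid y).1]⟩)).1
    simpa [(hid x).2] using h
  exact ⟨htotal, fun x y z => (hS x y z (Or.inl ⟨htotal x y, htotal y z⟩)).2, hid⟩
end

section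
/- Let P be a poloid. Define μ(x) to be the partial function on P with Dom(μ(x)) = {t ∈ P | xt is defined} and μ(x)(t) = xt. Then: each μ(x) has nonempty domain; μ is injective; for x, y ∈ P, xy is defined if and only if μ(x)∘μ(y) is defined (where for partial functions f, g on P, f∘g is defined iff Dom(f) ⊇ im(g), with Dom(f∘g) = Dom(g) and (f∘g)(t) = f(g(t))); when xy is defined, μ(xy) = μ(x)∘μ(y); and for every unit e of P, μ(e) is the identity partial function on its domain (μ(e)(t) = t for all t ∈ Dom(μ(e))). -/
/-- The left regular representation of a poloid: `μ(x)` is the partial function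
`t ↦ xt` with domain `{t | xt defined}`. -/
def μop {M : Type*} (op : M → M → Option M) (x : M) : M →. M :=
  fun t => Part.ofOption (op x t)

/-- Membership in a value of the left regular representation. -/
theorem mem_μop {M : Type*} {op : M → M → Option M} {x t y : M} :
    y ∈ μop op x t ↔ op x t = some y := by
  simp [μop]

/-- Membership in the domain of the left regular representation. -/
theorem mem_dom_μop {M : Type*} {op : M → M → Option M} {x t : M} :
    t ∈ (μop op x).Dom ↔ (op x t).isSome := by
  simp [PFun.mem_dom, mem_μop, Option.isSome_iff_exists]

/-- Every element of a poloid is fixed by right multiplication by some unit. -/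
theorem IsPoloid.exists_right_unit {M : Type*} {op : M → M → Option M} (hP : IsPoloid op)
    (x : M) : ∃ e, OIsUnit op e ∧ op x e = some x := by
  obtain ⟨_, e, -, he, -, hx⟩ := hP.2 x
  obtain ⟨y, hy⟩ := Option.isSome_iff_exists.mp hx
  exact ⟨e, he, by rw [hy, he.2 x y hy]⟩

/-- Lemma on the left regular representation: each `μ(x)` has nonempty domain, `μ` is
injective, `xy` is defined iff `μ(x)∘μ(y)` is defined, `μ(xy) = μ(x)∘μ(y)` when `xy` is
defined, and `μ(e)` is an identity partial function for every unit `e`. -/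
theorem stmt15 {M : Type*} (op : M → M → Option M) (hP : IsPoloid op) :
    (∀ x : M, (μop op x).Dom.Nonempty) ∧
    Function.Injective (μop op) ∧
    (∀ x y : M, (op x y).isSome ↔ PComposable (μop op x) (μop op y)) ∧
    (∀ x y z : M, op x y = some z → μop op z = pcomp (μop op x) (μop op y)) ∧
    (∀ e : M, OIsUnit op e → ∀ t : M, ∀ y ∈ μop op e t, y = t) := by
  refine ⟨fun x => ?_, fun x y hxy => ?_, fun x y => ⟨?_, fun h => ?_⟩, fun x y z hz => ?_,
    fun e he t y hy => he.1 t y (mem_μop.mp hy)⟩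
  · obtain ⟨e, -, hx⟩ := hP.exists_right_unit x
    exact ⟨e, mem_dom_μop.mpr (by simp [hx])⟩
  · obtain ⟨e, he, hx⟩ := hP.exists_right_unit x
    have hy : x ∈ μop op y e := hxy ▸ mem_μop.mpr hx
    exact he.2 y x (mem_μop.mp hy)
  · rintro h z ⟨t, hz⟩
    have hyt := mem_μop.mp hz
    obtain ⟨hs, heq⟩ := hP.1 x y t (Or.inl ⟨h, by simp [hyt]⟩)
    rw [heq, hyt, Option.bind_some] at hs
    exact mem_dom_μop.mpr hs
  · obtain ⟨e, -, hy⟩ := hP.exists_right_unit y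
    exact mem_dom_μop.mp (h ⟨e, mem_μop.mpr hy⟩)
  · have key (t : M) : op z t = (op y t).bind (op x) := by
      have h := hP.1 x y t
      rw [hz, Option.bind_some] at h
      by_cases h₁ : (op z t).isSome
      · exact (h (Or.inr (Or.inl h₁))).2
      by_cases h₂ : ((op y t).bind (op x)).isSome
      · exact (h (Or.inr (Or.inr h₂))).2
      rw [Option.not_isSome_iff_eq_none.mp h₁, Option.not_isSome_iff_eq_none.mp h₂]
    funext t
    ext w
    refine Iff.trans ?_ Part.mem_bind_iff.symm
    simp only [mem_μop, key, Option.bind_eq_some_iff]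
end

section
/- Let P be a right poloid and let ϵ ∈ P be a left unit. Then ϵϵ is defined and ϵϵ = ϵ. -/
/-- `e` is a left unit: `ex = x` whenever `ex` is defined. -/
def IsLeftUnit {M : Type*} (op : M → M → Option M) (e : M) : Prop :=
  ∀ x y, op e x = some y → y = x

/-- A right-directed semigroupoid: if `(xy)z` is defined, or `xy` and `yz` are both defined,
then `(xy)z` and `x(yz)` are defined and equal. -/
def IsRightDirectedSemigroupoid {M : Type*} (op : M → M → Option M) : Prop :=
  ∀ x y z : M,
    (((op x y).bind (fun w => op w z)).isSome ∨ ((op x y).isSome ∧ (op y z).isSome)) →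
    ((op x y).bind (fun w => op w z)).isSome ∧
      (op x y).bind (fun w => op w z) = (op y z).bind (fun w => op x w)

/-- A right poloid: a right-directed semigroupoid in which every `x` has a unique left unit
`φ` such that `xφ` is defined and `xφ = x`. -/
def IsRightPoloid {M : Type*} (op : M → M → Option M) : Prop :=
  IsRightDirectedSemigroupoid op ∧
    ∀ x : M, ∃! φ : M, IsLeftUnit op φ ∧ op x φ = some x

/-- In a right poloid, every left unit `ϵ` satisfies: `ϵϵ` is defined and `ϵϵ = ϵ`. -/
theorem stmt17 {M : Type*} (op : M → M → Option M) (hP : IsRightPoloid op)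
    (ϵ : M) (hϵ : IsLeftUnit op ϵ) :
    op ϵ ϵ = some ϵ := by
  obtain ⟨φ, ⟨-, hφ⟩, -⟩ := hP.2 ϵ
  obtain rfl : ϵ = φ := hϵ φ ϵ hφ
  exact hφ
end

section
/- Every domain pretransformation magma R on a nonempty set X is a right poloid: R is a right-directed semigroupoid under ∘, and for every f ∈ R there is a unique left unit φ ∈ R such that f∘φ is defined and f∘φ = f, namely φ = Id_{Dom(f)}. -/
/-- The identity pretransformation on `S ⊆ X`. -/
def IdP {X : Type*} (S : Set X) : X →. X := fun x => ⟨x ∈ S, fun _ => x⟩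

/-- A pretransformation magma on `X`: a set of partial functions on `X` with nonempty
domains, closed under composition. -/
def IsPfMagma {X : Type*} (R : Set (X →. X)) : Prop :=
  (∀ f ∈ R, f.Dom.Nonempty) ∧
  ∀ f ∈ R, ∀ g ∈ R, PComposable f g → pcomp f g ∈ R

/-- A domain pretransformation magma: a pretransformation magma containing `Id_{Dom(f)}`
for every `f` in it. -/
def IsDomainPfMagma {X : Type*} (R : Set (X →. X)) : Prop :=
  IsPfMagma R ∧ ∀ f ∈ R, IdP f.Dom ∈ R

theorem mem_pcomp {X : Type*} {f g : X →. X} {x y : X} :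
    y ∈ pcomp f g x ↔ ∃ z, z ∈ g x ∧ y ∈ f z :=
  Part.mem_bind_iff

theorem pcomposable_iff {X : Type*} {f g : X →. X} :
    PComposable f g ↔ ∀ x y, y ∈ g x → y ∈ f.Dom :=
  ⟨fun h x _ hy => h ⟨x, hy⟩, fun h y ⟨x, hy⟩ => h x y hy⟩

/-- A defined composite has the domain of its right factor. -/
theorem PComposable.dom_pcomp {X : Type*} {f g : X →. X} (h : PComposable f g) :
    (pcomp f g).Dom = g.Dom := by
  ext x
  exact ⟨fun ⟨hx, _⟩ => hx, fun hx => ⟨hx, h ⟨x, Part.get_mem hx⟩⟩⟩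

theorem pcomp_assoc {X : Type*} (f g h : X →. X) :
    pcomp (pcomp f g) h = pcomp f (pcomp g h) :=
  funext fun x => (Part.bind_assoc (h x) g f).symm

theorem PComposable.pcomp_right {X : Type*} {f g : X →. X} (h : X →. X)
    (hfg : PComposable f g) : PComposable f (pcomp g h) := by
  rw [pcomposable_iff]
  intro x y hy
  obtain ⟨z, _, hz⟩ := mem_pcomp.1 hy
  exact hfg ⟨z, hz⟩

theorem PComposable.pcomp_left_iff {X : Type*} {f g h : X →. X} (hfg : PComposable f g) :
    PComposable (pcomp f g) h ↔ PComposable g h := by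
  rw [PComposable, PComposable, hfg.dom_pcomp]

theorem mem_IdP {X : Type*} {S : Set X} {x y : X} : y ∈ IdP S x ↔ x ∈ S ∧ x = y :=
  ⟨fun ⟨hx, hy⟩ => ⟨hx, hy⟩, fun ⟨hx, hy⟩ => ⟨hx, hy⟩⟩

theorem IdP_pcomp {X : Type*} {S : Set X} {g : X →. X} (h : PComposable (IdP S) g) :
    pcomp (IdP S) g = g := by
  refine funext fun x => Part.ext fun y => mem_pcomp.trans ?_
  refine ⟨fun ⟨z, hz, hzy⟩ => ?_, fun hy => ⟨y, hy, mem_IdP.2 ⟨(h ⟨x, hy⟩ : y ∈ S), rfl⟩⟩⟩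
  obtain ⟨_, rfl⟩ := mem_IdP.1 hzy
  exact hz

theorem pcomposable_IdP_dom {X : Type*} (f : X →. X) : PComposable f (IdP f.Dom) := by
  rw [pcomposable_iff]
  intro x y hy
  obtain ⟨hx, rfl⟩ := mem_IdP.1 hy
  exact hx

theorem pcomp_IdP_dom {X : Type*} (f : X →. X) : pcomp f (IdP f.Dom) = f := by
  refine funext fun x => Part.ext fun y => mem_pcomp.trans ?_
  refine ⟨fun ⟨z, hz, hy⟩ => ?_, fun hy => ⟨x, mem_IdP.2 ⟨hy.1, rfl⟩, hy⟩⟩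
  obtain ⟨_, rfl⟩ := mem_IdP.1 hz
  exact hy

/-- Every domain pretransformation magma is a right poloid: it is a right-directed
semigroupoid under `∘`, and every member `f` has `Id_{Dom(f)}` as its unique left unit
`φ` with `f∘φ` defined and equal to `f`. -/
theorem stmt18 {X : Type*} [Nonempty X] (R : Set (X →. X)) (hR : IsDomainPfMagma R) :
    (∀ f ∈ R, ∀ g ∈ R, ∀ h ∈ R,
      ((PComposable f g ∧ PComposable (pcomp f g) h) ∨
        (PComposable f g ∧ PComposable g h)) →
      (PComposable f g ∧ PComposable (pcomp f g) h) ∧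
      (PComposable g h ∧ PComposable f (pcomp g h)) ∧
      pcomp (pcomp f g) h = pcomp f (pcomp g h)) ∧
    (∀ f ∈ R,
      IdP f.Dom ∈ R ∧
      (∀ g ∈ R, PComposable (IdP f.Dom) g → pcomp (IdP f.Dom) g = g) ∧
      PComposable f (IdP f.Dom) ∧ pcomp f (IdP f.Dom) = f ∧
      (∀ φ ∈ R, (∀ g ∈ R, PComposable φ g → pcomp φ g = g) →
        PComposable f φ → pcomp f φ = f → φ = IdP f.Dom)) := by
  refine ⟨fun f _ g _ h _ H => ?_, fun f hf => ⟨hR.2 f hf, fun g _ => IdP_pcomp,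
    pcomposable_IdP_dom f, pcomp_IdP_dom f, fun φ hφ hunit hfφ heq => ?_⟩⟩
  · have hfg : PComposable f g := H.elim And.left And.left
    have hgh : PComposable g h := H.elim (fun H => hfg.pcomp_left_iff.1 H.2) And.right
    exact ⟨⟨hfg, hfg.pcomp_left_iff.2 hgh⟩, ⟨hgh, hfg.pcomp_right h⟩, pcomp_assoc f g h⟩
  · have hdom : φ.Dom = f.Dom := by rw [← hfφ.dom_pcomp, heq]
    rw [← hdom, ← hunit _ (hR.2 φ hφ) (pcomposable_IdP_dom φ), pcomp_IdP_dom]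
end

section
/- A right poloid P is unit-posetal if and only if it is normal; that is, the natural preorder ≤ on P (given by x ≤ y iff yφ_x is defined and x = yφ_x) is antisymmetric on the set of left units of P if and only if, whenever φ_x φ_y and φ_y φ_x are both defined for x, y ∈ P, one has φ_x = φ_y. -/
theorem IsLeftUnit.eq_of_op_eq_some_self {M : Type*} {op : M → M → Option M} {e f : M}
    (he : IsLeftUnit op e) (h : op e f = some e) : f = e :=
  (he f e h).symm

theorem IsLeftUnit.op_eq_some_of_isSome {M : Type*} {op : M → M → Option M} {e x : M}
    (he : IsLeftUnit op e) (h : (op e x).isSome) : op e x = some x := by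
  obtain ⟨y, hy⟩ := Option.isSome_iff_exists.mp h
  rw [hy, he x y hy]

/-- A right poloid is unit-posetal if and only if it is normal: the natural preorder
`x ≤ y ↔ (yφ_x` is defined and `x = yφ_x)` is antisymmetric on left units if and only if
`φ_x φ_y` and `φ_y φ_x` both being defined implies `φ_x = φ_y`. -/
theorem stmt19 {M : Type*} (op : M → M → Option M) (hP : IsRightPoloid op)
    (φ : M → M)
    (hφ : ∀ x : M, IsLeftUnit op (φ x) ∧ op x (φ x) = some x ∧
      ∀ ψ : M, IsLeftUnit op ψ → op x ψ = some x → ψ = φ x) :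
    (∀ ϵ ϵ' : M, IsLeftUnit op ϵ → IsLeftUnit op ϵ' →
        op ϵ' (φ ϵ) = some ϵ → op ϵ (φ ϵ') = some ϵ' → ϵ = ϵ') ↔
      (∀ x y : M, (op (φ x) (φ y)).isSome → (op (φ y) (φ x)).isSome → φ x = φ y) := by
  have φ_unit : ∀ e, IsLeftUnit op e → φ e = e := fun e he =>
    he.eq_of_op_eq_some_self (hφ e).2.1
  constructor
  · intro h x y hxy hyx
    have hx := (hφ x).1
    have hy := (hφ y).1
    apply h _ _ hx hy
    · rw [φ_unit _ hx]
      exact hy.op_eq_some_of_isSome hyx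
    · rw [φ_unit _ hy]
      exact hx.op_eq_some_of_isSome hxy
  · intro h e f he hf hfe hef
    have := h e f
    rw [φ_unit e he, φ_unit f hf] at *
    exact this (by simp [hef]) (by simp [hfe])
end
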